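/- Unrolled replicas of looping states and the FG conjunct of the translated interpolant. Let w be a word over V that is ultimately periodic with transient length m and period h ≥ 1, let u : ℕ, and let B_p be a predicate on valuations for each position p, such that B_{m + r*h + j} (w (m + r*h + j)) holds for every r ≤ u and every j < h (each replica's state component holds at its position). Then, since every unrolled replica is a replicate of the corresponding looping state, there exists T such that for every t ≥ T there exists j < h with B_{m+u*h+j} (w t) holding and, for every r < u, B_{m+r*h+j} (w t) holding; that is, w satisfies FG ⋁_{j<h} (B_{m+u*h+j} ∧ ⋀_{r<u} B_{m+r*h+j}). -/

import Mathlib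

/-- Shifting a position past the transient by a multiple of the period does not change the
letter. -/
theorem eq_add_mul_of_ultimately_periodic {α : Type*} {w : ℕ → α} {m h : ℕ}
    (hper : ∀ n, m ≤ n → w (n + h) = w n) (r j : ℕ) : w (m + r * h + j) = w (m + j) := by
  induction r with
  | zero => simp
  | succ r ih =>
    rw [← ih, ← hper (m + r * h + j) (by omega)]
    congr 1
    ring

/-- **Unrolled replicas of looping states and the FG conjunct of the translated
interpolant.**  If the state component of each replica of each looping state holds at the
corresponding position of the ultimately periodic word `w`, then `w` satisfies
`FG ⋁_{j<h} (B_{m+u*h+j} ∧ ⋀_{r<u} B_{m+r*h+j})`. -/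
theorem unrolled_replicas_FG
    {V : Type*} [Fintype V]
    (w : ℕ → V → Bool) (m h u : ℕ) (hh : 1 ≤ h)
    (hper : ∀ n, m ≤ n → w (n + h) = w n)
    (B : ℕ → (V → Bool) → Prop)
    (hB : ∀ r ≤ u, ∀ j < h, B (m + r * h + j) (w (m + r * h + j))) :
    ∃ T, ∀ t ≥ T, ∃ j < h,
      B (m + u * h + j) (w t) ∧ ∀ r < u, B (m + r * h + j) (w t) := by
  refine ⟨m, fun t ht => ⟨(t - m) % h, Nat.mod_lt _ hh, ?_⟩⟩
  have key : ∀ r ≤ u, B (m + r * h + (t - m) % h) (w t) := by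
    intro r hr
    have hdiv := Nat.div_add_mod' (t - m) h
    have hrep : w t = w (m + r * h + (t - m) % h) := by
      rw [eq_add_mul_of_ultimately_periodic hper r,
        ← eq_add_mul_of_ultimately_periodic hper ((t - m) / h)]
      congr 1
      omega
    rw [hrep]
    exact hB r hr _ (Nat.mod_lt _ hh)
  exact ⟨key u le_rfl, fun r hr => key r hr.le⟩
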